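/- Let A be an n×q real matrix, y ∈ ℝⁿ, λ_nw > 0, let Ω̲ be a norm on ℝ^q, and let γ̂ minimize γ ↦ ‖y − Aγ‖²/n + 2λ_nw·Ω̲(γ) over all of ℝ^q. Then Ω̲_*(A'(y − Aγ̂)/n) ≤ λ_nw, where Ω̲_*(w) := sup{|w'v| : v ∈ ℝ^q, Ω̲(v) ≤ 1} is the dual norm of Ω̲. -/

import Mathlib

open scoped BigOperators
open Matrix

/-- `N` is a norm on `ℝ^q`. -/
def IsNorm {q : ℕ} (N : (Fin q → ℝ) → ℝ) : Prop :=
  (∀ x, 0 ≤ N x) ∧ (∀ x, N x = 0 ↔ x = 0) ∧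
  (∀ (c : ℝ) (x : Fin q → ℝ), N (c • x) = |c| * N x) ∧
  (∀ x y, N (x + y) ≤ N x + N y)

/-- The dual norm `N_*(w) := sup{|w'v| : N v ≤ 1}`. -/
noncomputable def dualNorm {q : ℕ} (N : (Fin q → ℝ) → ℝ) (w : Fin q → ℝ) : ℝ :=
  sSup {r : ℝ | ∃ v : Fin q → ℝ, N v ≤ 1 ∧ r = |∑ i, w i * v i|}

/-- KKT/dual-norm bound at the nodewise regression minimizer (used for (that3)). -/
theorem statement9 {n q : ℕ} (hn : 0 < n)
    (A : Matrix (Fin n) (Fin q) ℝ) (y : Fin n → ℝ)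
    (lamNw : ℝ) (hlam : 0 < lamNw)
    (Ωu : (Fin q → ℝ) → ℝ) (hΩu : IsNorm Ωu)
    (γhat : Fin q → ℝ)
    (hopt : ∀ γ : Fin q → ℝ,
      (∑ i, (y i - A.mulVec γhat i) ^ 2) / (n : ℝ) + 2 * lamNw * Ωu γhat ≤
        (∑ i, (y i - A.mulVec γ i) ^ 2) / (n : ℝ) + 2 * lamNw * Ωu γ) :
    dualNorm Ωu ((n : ℝ)⁻¹ • (Aᵀ.mulVec (y - A.mulVec γhat))) ≤ lamNw := by
  obtain ⟨h0, _, hsm, hadd⟩ := hΩu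
  have hn' : (0 : ℝ) < n := by exact_mod_cast hn
  have key : ∀ v : Fin q → ℝ, Ωu v ≤ 1 →
      ∑ i, ((n : ℝ)⁻¹ • (Aᵀ.mulVec (y - A.mulVec γhat))) i * v i ≤ lamNw := by
    intro v hv
    have hs : ∑ i, ((n : ℝ)⁻¹ • (Aᵀ.mulVec (y - A.mulVec γhat))) i * v i
        = (∑ i, (y i - A.mulVec γhat i) * A.mulVec v i) / n := by
      change ((n : ℝ)⁻¹ • (Aᵀ.mulVec (y - A.mulVec γhat))) ⬝ᵥ v
        = ((y - A.mulVec γhat) ⬝ᵥ A.mulVec v) / n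
      rw [smul_dotProduct, Matrix.mulVec_transpose, ← Matrix.dotProduct_mulVec, smul_eq_mul]
      ring
    rw [hs]
    set s := (∑ i, (y i - A.mulVec γhat i) * A.mulVec v i) / (n : ℝ) with hsdef
    set K := (∑ i, (A.mulVec v i) ^ 2) / (n : ℝ) with hK
    have hK0 : 0 ≤ K := div_nonneg (Finset.sum_nonneg fun i _ => sq_nonneg _) hn'.le
    by_contra hlt
    push Not at hlt
    have ht : ∀ t : ℝ, 0 < t → 2 * t * s ≤ t ^ 2 * K + 2 * lamNw * t := by
      intro t ht
      have h1 := hopt (γhat + t • v)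
      have h2 : (∑ i, (y i - A.mulVec (γhat + t • v) i) ^ 2) / (n : ℝ)
          = (∑ i, (y i - A.mulVec γhat i) ^ 2) / (n : ℝ) - 2 * t * s + t ^ 2 * K := by
        have h3 : ∑ i, (y i - A.mulVec (γhat + t • v) i) ^ 2
            = ∑ i, (y i - A.mulVec γhat i) ^ 2
              - 2 * t * ∑ i, (y i - A.mulVec γhat i) * A.mulVec v i
              + t ^ 2 * ∑ i, (A.mulVec v i) ^ 2 := by
          rw [Finset.mul_sum, Finset.mul_sum, ← Finset.sum_sub_distrib, ← Finset.sum_add_distrib]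
          refine Finset.sum_congr rfl fun i _ => ?_
          rw [Matrix.mulVec_add, Matrix.mulVec_smul]
          simp only [Pi.add_apply, Pi.smul_apply, smul_eq_mul]
          ring
        rw [h3, hsdef, hK]
        ring
      have h4 : Ωu (γhat + t • v) ≤ Ωu γhat + t := by
        have h5 := hadd γhat (t • v)
        rw [hsm, abs_of_pos ht] at h5
        nlinarith
      rw [h2] at h1
      nlinarith
    have hp : 0 < (s - lamNw) / (K + 1) := div_pos (by linarith) (by linarith)
    have h6 := ht _ hp
    set t := (s - lamNw) / (K + 1) with htdef
    have h7 : t * (K + 1) = s - lamNw := by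
      rw [htdef]; field_simp
    have h8 : t * (2 * (s - lamNw)) ≤ t * (t * K) := by nlinarith
    have h9 := le_of_mul_le_mul_left h8 hp
    nlinarith
  unfold dualNorm
  refine Real.sSup_le ?_ hlam.le
  rintro r ⟨v, hv, rfl⟩
  refine abs_le.2 ⟨?_, key v hv⟩
  have h1 := key (-v) (by
    have := hsm (-1) v
    simp only [neg_smul, one_smul, abs_neg, abs_one, one_mul] at this
    rw [this]; exact hv)
  simp only [Pi.neg_apply, mul_neg, Finset.sum_neg_distrib] at h1
  linarith
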